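/- Suppose sec ≥ α for some real number α. Then for every traceless symmetric bilinear form φ on E, Q̊(φ) ≥ n α ‖φ‖² − Σ_{i,j,k} Ric(e_i,e_j) φ(e_i,e_k) φ(e_j,e_k). -/

import Mathlib

open scoped RealInnerProductSpace

lemma bilin_trace_indep {E : Type*} [NormedAddCommGroup E] [InnerProductSpace ℝ E]
    {n : ℕ} (e f : OrthonormalBasis (Fin n) ℝ E) (B : E →ₗ[ℝ] E →ₗ[ℝ] ℝ) :
    ∑ i, B (e i) (e i) = ∑ a, B (f a) (f a) := by
  have h : ∀ a, B (f a) (f a) = ∑ i, ∑ j, (⟪e i, f a⟫ * ⟪f a, e j⟫) * B (e i) (e j) := by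
    intro a
    conv_lhs => rw [← e.sum_repr' (f a)]
    simp only [map_sum, LinearMap.sum_apply, map_smul, LinearMap.smul_apply, smul_eq_mul,
      Finset.mul_sum]
    rw [Finset.sum_comm]
    refine Finset.sum_congr rfl fun i _ => Finset.sum_congr rfl fun j _ => ?_
    rw [real_inner_comm (e j) (f a)]
    ring
  simp only [h]
  rw [Finset.sum_comm]
  refine Finset.sum_congr rfl fun i _ => ?_
  rw [Finset.sum_comm]
  simp only [← Finset.sum_mul, f.sum_inner_mul_inner]
  simp [OrthonormalBasis.inner_eq_ite]

lemma bilin_trace_indep' {E : Type*} [NormedAddCommGroup E] [InnerProductSpace ℝ E]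
    {n : ℕ} (e f : OrthonormalBasis (Fin n) ℝ E) (B : E → E → ℝ)
    (h1 : ∀ x y z, B (x + y) z = B x z + B y z) (h2 : ∀ (c : ℝ) x z, B (c • x) z = c • B x z)
    (h3 : ∀ x y z, B x (y + z) = B x y + B x z) (h4 : ∀ (c : ℝ) x z, B x (c • z) = c • B x z) :
    ∑ i, B (e i) (e i) = ∑ a, B (f a) (f a) :=
  bilin_trace_indep e f (LinearMap.mk₂ ℝ B h1 h2 h3 h4)

/-- If `sec ≥ α`, then for every traceless symmetric bilinear form `φ`,
`Q̊(φ) ≥ n α ‖φ‖² − Σ_{i,j,k} Ric(e_i,e_j) φ(e_i,e_k) φ(e_j,e_k)`, where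
`Ric(X,Y) = Σ_m R(e_m,X,e_m,Y)`, `‖φ‖² = Σ_{i,j} φ(e_i,e_j)²` and
`Q̊(φ) = Σ_{i,j,k,l} R(e_i,e_k,e_l,e_j) φ(e_k,e_l) φ(e_i,e_j)`. -/
theorem stmt_3
    {E : Type*} [NormedAddCommGroup E] [InnerProductSpace ℝ E]
    {n : ℕ} (hn : 2 ≤ n) (e : OrthonormalBasis (Fin n) ℝ E)
    (R : E →ₗ[ℝ] E →ₗ[ℝ] E →ₗ[ℝ] E →ₗ[ℝ] ℝ)
    (hR1 : ∀ X Y Z W : E, R X Y Z W = - R Y X Z W)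
    (hR2 : ∀ X Y Z W : E, R X Y Z W = - R X Y W Z)
    (hR3 : ∀ X Y Z W : E, R X Y Z W = R Z W X Y)
    (hR4 : ∀ X Y Z W : E, R X Y Z W + R Y Z X W + R Z X Y W = 0)
    (α : ℝ)
    (hsec : ∀ X Y : E, α * (‖X‖ ^ 2 * ‖Y‖ ^ 2 - ⟪X, Y⟫ ^ 2) ≤ R X Y X Y)
    (φ : E →ₗ[ℝ] E →ₗ[ℝ] ℝ)
    (hφsymm : ∀ X Y : E, φ X Y = φ Y X)
    (hφtr : ∑ i, φ (e i) (e i) = 0) :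
    (n : ℝ) * α * (∑ i, ∑ j, (φ (e i) (e j)) ^ 2)
        - (∑ i, ∑ j, ∑ k, (∑ m, R (e m) (e i) (e m) (e j)) * φ (e i) (e k) * φ (e j) (e k))
      ≤ ∑ i, ∑ j, ∑ k, ∑ l, R (e i) (e k) (e l) (e j) * φ (e k) (e l) * φ (e i) (e j) := by
  have : FiniteDimensional ℝ E := e.toBasis.finiteDimensional_of_finite
  have hfr : Module.finrank ℝ E = n := by
    rw [Module.finrank_eq_card_basis e.toBasis, Fintype.card_fin]
  obtain ⟨T, hT⟩ : ∃ T : E →ₗ[ℝ] E, ∀ x, T x = ∑ i, φ x (e i) • e i :=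
    ⟨∑ i, (φ.flip (e i)).smulRight (e i), fun x => by simp [LinearMap.sum_apply]⟩
  have hTφ : ∀ x y, ⟪T x, y⟫ = φ x y := by
    intro x y
    conv_rhs => rw [← e.sum_repr' y]
    simp only [hT, sum_inner, inner_smul_left, map_sum, map_smul, smul_eq_mul]
    exact Finset.sum_congr rfl fun i _ => by simp [mul_comm]
  have hsym : T.IsSymmetric := fun x y => by
    rw [hTφ, real_inner_comm, hTφ, hφsymm]
  let f : OrthonormalBasis (Fin n) ℝ E := hsym.eigenvectorBasis hfr
  obtain ⟨lam, hlam⟩ : ∃ lam : Fin n → ℝ, ∀ a, T (f a) = lam a • f a :=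
    ⟨hsym.eigenvalues hfr, fun a => hsym.apply_eigenvectorBasis hfr a⟩
  have hφf : ∀ a b, φ (f a) (f b) = lam a * (if a = b then 1 else 0) := by
    intro a b
    rw [← hTφ, hlam, real_inner_smul_left, OrthonormalBasis.inner_eq_ite]
  -- trace
  have htr : ∑ a, lam a = 0 := by
    rw [bilin_trace_indep e f φ] at hφtr
    simpa [hφf] using hφtr
  -- norm
  have hnorm : ∑ i, ∑ j, (φ (e i) (e j)) ^ 2 = ∑ a, lam a ^ 2 := by
    have h1 : ∑ i, ∑ j, (φ (e i) (e j)) ^ 2 = ∑ i, φ (e i) (T (e i)) := by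
      refine Finset.sum_congr rfl fun i _ => ?_
      simp only [hT, map_sum, map_smul, smul_eq_mul, sq]
    rw [h1, bilin_trace_indep' e f (fun x y => φ x (T y)) (by simp) (by simp) (by simp) (by simp)]
    refine Finset.sum_congr rfl fun a _ => ?_
    simp only [hlam, map_smul, hφf, smul_eq_mul, if_true]
    ring
  -- Ricci term
  have hric : (∑ i, ∑ j, ∑ k, (∑ m, R (e m) (e i) (e m) (e j)) * φ (e i) (e k) * φ (e j) (e k))
      = ∑ a, ∑ b, lam b ^ 2 * R (f a) (f b) (f a) (f b) := by
    have h1 : (∑ i, ∑ j, ∑ k, (∑ m, R (e m) (e i) (e m) (e j)) * φ (e i) (e k) * φ (e j) (e k))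
        = ∑ k, ∑ m, R (e m) (T (e k)) (e m) (T (e k)) := by
      simp only [hT, map_sum, map_smul, LinearMap.sum_apply, LinearMap.smul_apply, smul_eq_mul,
        Finset.sum_mul, Finset.mul_sum]
      calc _ = ∑ i, ∑ k, ∑ j, ∑ m, R (e m) (e i) (e m) (e j) * φ (e i) (e k) * φ (e j) (e k) :=
            Finset.sum_congr rfl fun i _ => Finset.sum_comm
        _ = ∑ k, ∑ i, ∑ j, ∑ m, R (e m) (e i) (e m) (e j) * φ (e i) (e k) * φ (e j) (e k) :=
            Finset.sum_comm
        _ = ∑ k, ∑ i, ∑ m, ∑ j, R (e m) (e i) (e m) (e j) * φ (e i) (e k) * φ (e j) (e k) :=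
            Finset.sum_congr rfl fun k _ => Finset.sum_congr rfl fun i _ => Finset.sum_comm
        _ = ∑ k, ∑ m, ∑ i, ∑ j, R (e m) (e i) (e m) (e j) * φ (e i) (e k) * φ (e j) (e k) :=
            Finset.sum_congr rfl fun k _ => Finset.sum_comm
        _ = ∑ k, ∑ m, ∑ j, ∑ i, R (e m) (e i) (e m) (e j) * φ (e i) (e k) * φ (e j) (e k) :=
            Finset.sum_congr rfl fun k _ => Finset.sum_congr rfl fun i _ => Finset.sum_comm
        _ = _ := by
            refine Finset.sum_congr rfl fun k _ => Finset.sum_congr rfl fun m _ =>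
              Finset.sum_congr rfl fun j _ => Finset.sum_congr rfl fun i _ => ?_
            rw [hφsymm (e i), hφsymm (e j)]
            ring
    rw [h1]
    have h2 : ∀ k, ∑ m, R (e m) (T (e k)) (e m) (T (e k))
        = ∑ a, R (f a) (T (e k)) (f a) (T (e k)) := fun k =>
      bilin_trace_indep' e f (fun x y => R x (T (e k)) y (T (e k)))
        (by simp) (by simp) (by simp) (by simp)
    simp only [h2]
    rw [Finset.sum_comm]
    refine Finset.sum_congr rfl fun a _ => ?_
    rw [bilin_trace_indep' e f (fun x y => R (f a) (T x) (f a) (T y))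
        (by simp) (by simp) (by simp) (by simp)]
    refine Finset.sum_congr rfl fun b _ => ?_
    simp only [hlam, map_smul, LinearMap.smul_apply, smul_eq_mul]
    ring
  -- curvature term
  have hQ : (∑ i, ∑ j, ∑ k, ∑ l, R (e i) (e k) (e l) (e j) * φ (e k) (e l) * φ (e i) (e j))
      = ∑ a, ∑ b, -(lam a * lam b * R (f a) (f b) (f a) (f b)) := by
    have h1 : (∑ i, ∑ j, ∑ k, ∑ l, R (e i) (e k) (e l) (e j) * φ (e k) (e l) * φ (e i) (e j))
        = ∑ i, ∑ k, R (e i) (e k) (T (e k)) (T (e i)) := by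
      simp only [hT, map_sum, map_smul, LinearMap.sum_apply, LinearMap.smul_apply, smul_eq_mul,
        Finset.mul_sum]
      refine Finset.sum_congr rfl fun i _ => ?_
      rw [Finset.sum_comm]
      refine Finset.sum_congr rfl fun k _ => Finset.sum_congr rfl fun j _ =>
        Finset.sum_congr rfl fun l _ => ?_
      ring
    rw [h1]
    have h2 : ∀ i, ∑ k, R (e i) (e k) (T (e k)) (T (e i))
        = ∑ b, R (e i) (f b) (T (f b)) (T (e i)) := fun i =>
      bilin_trace_indep' e f (fun x y => R (e i) x (T y) (T (e i)))
        (by simp) (by simp) (by simp) (by simp)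
    simp only [h2]
    rw [Finset.sum_comm, Finset.sum_comm (s := Finset.univ (α := Fin n)) (t := Finset.univ)
      (f := fun a b => -(lam a * lam b * R (f a) (f b) (f a) (f b)))]
    refine Finset.sum_congr rfl fun b _ => ?_
    rw [bilin_trace_indep' e f (fun x y => R x (f b) (T (f b)) (T y))
        (by simp) (by simp) (by simp) (by simp)]
    refine Finset.sum_congr rfl fun a _ => ?_
    simp only [hlam, map_smul, LinearMap.smul_apply, smul_eq_mul]
    rw [hR2 (f a) (f b) (f b) (f a)]
    ring
  rw [hnorm, hric, hQ]
  have hK : ∀ a b, α * (lam a - lam b) ^ 2 ≤ (lam a - lam b) ^ 2 * R (f a) (f b) (f a) (f b) := by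
    intro a b
    by_cases hab : a = b
    · simp [hab]
    · have h := hsec (f a) (f b)
      rw [OrthonormalBasis.inner_eq_ite, if_neg hab, f.norm_eq_one, f.norm_eq_one] at h
      nlinarith [sq_nonneg (lam a - lam b)]
  have hsum := Finset.sum_le_sum fun a (_ : a ∈ Finset.univ) =>
    Finset.sum_le_sum fun b (_ : b ∈ Finset.univ) => hK a b
  have hL : ∑ a, ∑ b, α * (lam a - lam b) ^ 2 = 2 * (n * α * ∑ a, lam a ^ 2) := by
    have : ∀ a b, α * (lam a - lam b) ^ 2
        = α * lam a ^ 2 + α * lam b ^ 2 - 2 * α * lam a * lam b := fun a b => by ring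
    simp only [this, Finset.sum_add_distrib, Finset.sum_sub_distrib, ← Finset.mul_sum, htr,
      Finset.sum_const, Finset.card_univ, Fintype.card_fin, nsmul_eq_mul, mul_zero]
    ring
  have hS : ∑ a, ∑ b, lam a ^ 2 * R (f a) (f b) (f a) (f b)
      = ∑ a, ∑ b, lam b ^ 2 * R (f a) (f b) (f a) (f b) := by
    rw [Finset.sum_comm]
    refine Finset.sum_congr rfl fun a _ => Finset.sum_congr rfl fun b _ => ?_
    rw [hR1 (f b), hR2 (f a) (f b) (f b) (f a)]
    ring
  have hRr : ∑ a, ∑ b, (lam a - lam b) ^ 2 * R (f a) (f b) (f a) (f b)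
      = ∑ a, ∑ b, lam a ^ 2 * R (f a) (f b) (f a) (f b)
        + ∑ a, ∑ b, lam b ^ 2 * R (f a) (f b) (f a) (f b)
        + 2 * ∑ a, ∑ b, -(lam a * lam b * R (f a) (f b) (f a) (f b)) := by
    simp only [Finset.mul_sum, ← Finset.sum_add_distrib]
    refine Finset.sum_congr rfl fun a _ => Finset.sum_congr rfl fun b _ => ?_
    ring
  rw [hL, hRr, hS] at hsum
  linarith
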